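/- Let 𝓛_R be a closed linear subspace of 𝓛 containing all constant gambles and Σ≥ ⊆ 𝓛≥ ∩ 𝓛_R a convex cone, closed in 𝓛_R, containing all nonnegative constant gambles. Then the following are equivalent: (a) there exists a P-coherent set of desirable gambles C ⊆ 𝓛_R containing a gamble g with sup g < 0 and g ∉ Σ< (a negative gamble that is not P-negative); (b) Σ≥ ⊊ 𝓛≥ ∩ 𝓛_R. -/

import Mathlib

open BoundedContinuousFunction

noncomputable section

/-- The set of nonnegative gambles `𝓛≥`. -/
def Lnn (Ω : Type*) [TopologicalSpace Ω] : Set (Ω →ᵇ ℝ) := {g | ∀ ω, 0 ≤ g ω}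

/-- `posi 𝒢`: all finite nonnegative linear combinations of elements of `𝒢`. -/
def posi {Ω : Type*} [TopologicalSpace Ω] (𝒢 : Set (Ω →ᵇ ℝ)) : Set (Ω →ᵇ ℝ) :=
  {h | ∃ (ℓ : ℕ) (lam : Fin ℓ → ℝ) (gs : Fin ℓ → Ω →ᵇ ℝ),
    (∀ i, 0 ≤ lam i) ∧ (∀ i, gs i ∈ 𝒢) ∧ h = ∑ i, lam i • gs i}

/-- The set `Σ<` of P-negative gambles relative to `Σ≥` and `𝓛_R`. -/
def Sneg {Ω : Type*} [TopologicalSpace Ω] (LR : Submodule ℝ (Ω →ᵇ ℝ))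
    (Sig : Set (Ω →ᵇ ℝ)) : Set (Ω →ᵇ ℝ) :=
  {f | f ∈ LR ∧ ∃ δ : ℝ, 0 < δ ∧
    -f - δ • BoundedContinuousFunction.const Ω (1 : ℝ) ∈ Sig}

/-- A P-coherent set of desirable gambles: the closure of `posi (Σ≥ ∪ 𝒢)` for
some `𝒢 ⊆ 𝓛_R`, disjoint from `Σ<`. -/
def PCoherent {Ω : Type*} [TopologicalSpace Ω] (LR : Submodule ℝ (Ω →ᵇ ℝ))
    (Sig : Set (Ω →ᵇ ℝ)) (C : Set (Ω →ᵇ ℝ)) : Prop :=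
  (∃ 𝒢 ⊆ (LR : Set (Ω →ᵇ ℝ)), C = closure (posi (Sig ∪ 𝒢))) ∧
    C ∩ Sneg LR Sig = ∅

/-- `posi 𝒢` is contained in every convex cone that contains `𝒢`. -/
theorem posi_subset {Ω : Type*} [TopologicalSpace Ω] {𝒢 K : Set (Ω →ᵇ ℝ)} (h : 𝒢 ⊆ K)
    (zero : 0 ∈ K) (add : ∀ x ∈ K, ∀ y ∈ K, x + y ∈ K)
    (smul : ∀ c : ℝ, 0 ≤ c → ∀ x ∈ K, c • x ∈ K) : posi 𝒢 ⊆ K := by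
  rintro _ ⟨ℓ, lam, gs, hlam, hgs, rfl⟩
  exact Finset.sum_induction _ (· ∈ K) (fun x y hx hy => add x hx y hy) zero
    fun i _ => smul _ (hlam i) _ (h (hgs i))

theorem subset_posi {Ω : Type*} [TopologicalSpace Ω] (𝒢 : Set (Ω →ᵇ ℝ)) : 𝒢 ⊆ posi 𝒢 :=
  fun g hg => ⟨1, fun _ => 1, fun _ => g, by simp, by simpa using hg, by simp⟩

/-- The cone generated by a cone `S` and a gamble `g`. -/
def adjoin {Ω : Type*} [TopologicalSpace Ω] (S : Set (Ω →ᵇ ℝ)) (g : Ω →ᵇ ℝ) :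
    Set (Ω →ᵇ ℝ) :=
  {h | ∃ s ∈ S, ∃ l : ℝ, 0 ≤ l ∧ h = s + l • g}

theorem add_mem_of_convex_cone {E : Type*} [AddCommGroup E] [Module ℝ E] {S : Set E}
    (hconv : Convex ℝ S) (hcone : ∀ c : ℝ, 0 < c → ∀ g ∈ S, c • g ∈ S) {x y : E}
    (hx : x ∈ S) (hy : y ∈ S) : x + y ∈ S := by
  have := hconv (hcone 2 two_pos x hx) (hcone 2 two_pos y hy)
    (a := 1 / 2) (b := 1 / 2) (by norm_num) (by norm_num) (by norm_num)
  simpa [smul_smul] using this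

theorem posi_union_singleton_subset_adjoin {Ω : Type*} [TopologicalSpace Ω]
    {S : Set (Ω →ᵇ ℝ)} (zero : 0 ∈ S) (add : ∀ x ∈ S, ∀ y ∈ S, x + y ∈ S)
    (smul : ∀ c : ℝ, 0 < c → ∀ x ∈ S, c • x ∈ S) (g : Ω →ᵇ ℝ) :
    posi (S ∪ {g}) ⊆ adjoin S g := by
  refine posi_subset ?_ ⟨0, zero, 0, le_rfl, by simp⟩ ?_ ?_
  · rintro x (hx | rfl)
    · exact ⟨x, hx, 0, le_rfl, by simp⟩
    · exact ⟨0, zero, 1, zero_le_one, by simp⟩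
  · rintro _ ⟨s, hs, l, hl, rfl⟩ _ ⟨t, ht, m, hm, rfl⟩
    exact ⟨s + t, add s hs t ht, l + m, add_nonneg hl hm, by module⟩
  · rintro c hc _ ⟨s, hs, l, hl, rfl⟩
    refine ⟨c • s, ?_, c * l, mul_nonneg hc hl, by module⟩
    rcases hc.eq_or_lt with rfl | hc
    · simpa using zero
    · exact smul c hc s hs

/-- If a negative constant can be approximated from the cone generated by `S` and `g`, then `-g`
lies in the closure of `S`. -/
theorem neg_mem_closure_of_neg_const_mem_closure_adjoin {Ω : Type*} [Nonempty Ω]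
    [TopologicalSpace Ω] {S : Set (Ω →ᵇ ℝ)} (nonneg : S ⊆ Lnn Ω)
    (add : ∀ x ∈ S, ∀ y ∈ S, x + y ∈ S)
    (smul : ∀ c : ℝ, 0 < c → ∀ x ∈ S, c • x ∈ S)
    (const_mem : ∀ c : ℝ, 0 ≤ c → const Ω c ∈ S)
    {g : Ω →ᵇ ℝ} {δ : ℝ} (hδ : 0 < δ) (h : -const Ω δ ∈ closure (adjoin S g)) :
    -g ∈ closure S := by
  rw [Metric.mem_closure_iff] at h ⊢
  intro r hr
  have hM : 0 < ‖g‖ + 1 := by positivity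
  obtain ⟨_, ⟨s, hs, l, hl, rfl⟩, hd⟩ :=
    h (min (δ / 2) (r * δ / (2 * (‖g‖ + 1)))) (by positivity)
  rw [dist_eq_norm, lt_min_iff] at hd
  obtain ⟨hd₁, hd₂⟩ := hd
  obtain ⟨ω⟩ := ‹Nonempty Ω›
  have hlM : δ / 2 ≤ l * (‖g‖ + 1) := by
    have h₁ := (norm_coe_le_norm (-const Ω δ - (s + l • g)) ω).trans hd₁.le
    have h₂ : 0 ≤ s ω := nonneg hs ω
    have h₃ := norm_coe_le_norm g ω
    simp only [Real.norm_eq_abs, abs_le, coe_sub, coe_neg, coe_add, coe_smul, Pi.sub_apply,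
      Pi.neg_apply, Pi.add_apply, const_apply, smul_eq_mul] at h₁ h₃
    nlinarith
  have hl : 0 < l := by
    by_contra hl'
    nlinarith
  refine ⟨l⁻¹ • (s + const Ω δ), smul _ (inv_pos.2 hl) _ (add _ hs _ (const_mem δ hδ.le)), ?_⟩
  have key : -g - l⁻¹ • (s + const Ω δ) = l⁻¹ • (-const Ω δ - (s + l • g)) := by
    rw [smul_sub, smul_add, smul_add, smul_smul, inv_mul_cancel₀ hl.ne']
    module
  rw [dist_eq_norm, key, norm_smul, norm_inv, Real.norm_of_nonneg hl.le, inv_mul_lt_iff₀ hl]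
  refine hd₂.trans_le ?_
  rw [div_le_iff₀ (by positivity)]
  nlinarith

/-- there exists a P-coherent set containing a negative gamble that
is not P-negative iff `Σ≥` is a proper subset of `𝓛≥ ∩ 𝓛_R`. -/
theorem stmt9 {Ω : Type*} [Nonempty Ω] [TopologicalSpace Ω] [DiscreteTopology Ω]
    (LR : Submodule ℝ (Ω →ᵇ ℝ)) (hLRclosed : IsClosed (LR : Set (Ω →ᵇ ℝ)))
    (hLRconst : ∀ c : ℝ, BoundedContinuousFunction.const Ω c ∈ LR)
    (Sig : Set (Ω →ᵇ ℝ)) (hSigsub : Sig ⊆ Lnn Ω ∩ (LR : Set (Ω →ᵇ ℝ)))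
    (hSigconv : Convex ℝ Sig) (hSigcone : ∀ c : ℝ, 0 < c → ∀ g ∈ Sig, c • g ∈ Sig)
    (hSigclosed : IsClosed Sig)
    (hSigconst : ∀ c : ℝ, 0 ≤ c → BoundedContinuousFunction.const Ω c ∈ Sig) :
    (∃ C : Set (Ω →ᵇ ℝ), PCoherent LR Sig C ∧
        ∃ g ∈ C, (⨆ ω, g ω) < 0 ∧ g ∉ Sneg LR Sig) ↔
      Sig ⊂ Lnn Ω ∩ (LR : Set (Ω →ᵇ ℝ)) := by
  have add : ∀ x ∈ Sig, ∀ y ∈ Sig, x + y ∈ Sig :=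
    fun x hx y hy => add_mem_of_convex_cone hSigconv hSigcone hx hy
  have zero : (0 : Ω →ᵇ ℝ) ∈ Sig := hSigconst 0 le_rfl
  have smul_one : ∀ c : ℝ, c • const Ω (1 : ℝ) = const Ω c := fun c => by ext; simp
  constructor
  · rintro ⟨C, ⟨⟨𝒢, h𝒢, rfl⟩, -⟩, g, hgC, hg, hgS⟩
    refine hSigsub.ssubset_of_ne fun hEq => hgS ?_
    have hgL : g ∈ LR := closure_minimal
      (posi_subset (Set.union_subset (fun x hx => (hSigsub hx).2) h𝒢) LR.zero_mem
        (fun x hx y hy => LR.add_mem hx hy) fun c _ x hx => LR.smul_mem c hx) hLRclosed hgC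
    refine ⟨hgL, -⨆ ω, g ω, neg_pos.2 hg, ?_⟩
    rw [smul_one, hEq]
    refine ⟨fun ω => ?_, LR.sub_mem (LR.neg_mem hgL) (hLRconst _)⟩
    simpa using le_ciSup g.isBounded_range.bddAbove ω
  · intro h
    obtain ⟨f, ⟨hf, hfL⟩, hfS⟩ := Set.exists_of_ssubset h
    obtain ⟨ε, hε, hfε⟩ : ∃ ε : ℝ, 0 < ε ∧ f + const Ω ε ∉ Sig := by
      by_contra! hall
      refine hfS (hSigclosed.closure_subset (Metric.mem_closure_iff.2 fun r hr =>
        ⟨_, hall (r / 2) (by positivity), ?_⟩))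
      rw [dist_self_add_right]
      exact ((norm_const_le (r / 2)).trans_eq (Real.norm_of_nonneg (by positivity))).trans_lt
        (half_lt_self hr)
    set g := -(f + const Ω ε) with hg
    have hgS : -g ∉ Sig := by rwa [hg, neg_neg]
    have hgL : g ∈ LR := LR.neg_mem (LR.add_mem hfL (hLRconst ε))
    refine ⟨closure (posi (Sig ∪ {g})), ⟨⟨{g}, by simpa using hgL, rfl⟩, ?_⟩, g,
      subset_closure (subset_posi _ (Or.inr rfl)), ?_, ?_⟩
    · rw [Set.eq_empty_iff_forall_notMem]
      rintro x ⟨hx, -, δ, hδ, hs⟩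
      rw [smul_one] at hs
      refine hgS (hSigclosed.closure_subset
        (neg_mem_closure_of_neg_const_mem_closure_adjoin (fun y hy => (hSigsub hy).1) add
          hSigcone hSigconst hδ ?_))
      have hx' := closure_mono (posi_union_singleton_subset_adjoin zero add hSigcone g) hx
      have := map_mem_closure (continuous_add_const (-x - const Ω δ)) hx'
        (t := adjoin Sig g) (by
          rintro _ ⟨s, hs', l, hl, rfl⟩
          exact ⟨s + (-x - const Ω δ), add _ hs' _ hs, l, hl, by module⟩)
      convert this using 1
      module
    · refine (ciSup_le fun ω => ?_).trans_lt (neg_neg_of_pos hε)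
      have := hf ω
      simp only [hg, coe_neg, coe_add, Pi.neg_apply, Pi.add_apply, const_apply]
      linarith
    · rintro ⟨-, δ, hδ, hs⟩
      rw [smul_one] at hs
      have := add _ hs _ (hSigconst δ hδ.le)
      rw [sub_add_cancel] at this
      exact hgS this
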